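/- Let M ≥ 2 be an integer, N_1,…,N_M positive integers, N := N_1+…+N_M, φ : {1,…,N} → {1,…,M} a map with #φ⁻¹(ĵ) = N_ĵ for each ĵ, and n > m ≥ 2 integers. For every t > 0, the function θ ↦ dim^t(θ) is differentiable at θ = 1, with derivative equal to 0. -/

import Mathlib

open Real
open scoped BigOperators Topology

/-- The entropy of a probability vector. -/
noncomputable def entropy {k : ℕ} (p : Fin k → ℝ) : ℝ := -∑ i, p i * Real.log (p i)

/-- If the entries of `q` sum to one, then the entropy of the mixture of the uniform vector and `q`
with weights `θ ^ t` and `1 - θ ^ t` has derivative zero at `θ = 1`. -/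
theorem hasDerivAt_entropy_mix_uniform {k : ℕ} (q : Fin k → ℝ) (hq : ∑ i, q i = 1) (t : ℝ) :
    HasDerivAt (fun θ : ℝ =>
      entropy (fun i : Fin k => θ ^ t * (1 / (k : ℝ)) + (1 - θ ^ t) * q i)) 0 1 := by
  have hk : (k : ℝ) ≠ 0 := by
    rintro h
    obtain rfl : k = 0 := by exact_mod_cast h
    simp at hq
  have hpow : HasDerivAt (fun θ : ℝ => θ ^ t) t 1 := by
    simpa using Real.hasDerivAt_rpow_const (x := 1) (p := t) (Or.inl one_ne_zero)
  have hterm : ∀ i ∈ Finset.univ, HasDerivAt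
      (fun θ : ℝ => (θ ^ t * (1 / (k : ℝ)) + (1 - θ ^ t) * q i) *
        Real.log (θ ^ t * (1 / (k : ℝ)) + (1 - θ ^ t) * q i))
      ((Real.log (1 / (k : ℝ)) + 1) * (t * (1 / (k : ℝ)) + -t * q i)) 1 := by
    intro i _
    have hp : HasDerivAt (fun θ : ℝ => θ ^ t * (1 / (k : ℝ)) + (1 - θ ^ t) * q i)
        (t * (1 / (k : ℝ)) + -t * q i) 1 :=
      (hpow.mul_const _).add ((hpow.const_sub 1).mul_const _)
    have hx : 1 / (k : ℝ) = 1 ^ t * (1 / (k : ℝ)) + (1 - 1 ^ t) * q i := by simp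
    exact (Real.hasDerivAt_mul_log (one_div_ne_zero hk)).comp_of_eq (1 : ℝ) hp hx
  have hsum : ∑ i, (Real.log (1 / (k : ℝ)) + 1) * (t * (1 / (k : ℝ)) + -t * q i) = 0 := by
    rw [← Finset.mul_sum, Finset.sum_add_distrib, ← Finset.mul_sum, ← Finset.mul_sum, hq]
    simp [field]
  have hmain := (HasDerivAt.fun_sum hterm).fun_neg
  rwa [hsum, neg_zero] at hmain

theorem dim_t_hasDerivAt_one
    (M : ℕ) (hM : 2 ≤ M) (Ncol : Fin M → ℕ) (hpos : ∀ j, 0 < Ncol j)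
    (N : ℕ) (hN : N = ∑ j, Ncol j)
    (φ : Fin N → Fin M) (hφ : ∀ j, (Finset.univ.filter (fun i => φ i = j)).card = Ncol j)
    (m n : ℕ) (hm : 2 ≤ m) (hmn : m < n)
    (t : ℝ) (ht : 0 < t) :
    HasDerivAt (fun θ : ℝ =>
        entropy (fun i : Fin N => θ ^ t * (1 / (N : ℝ)) +
            (1 - θ ^ t) * ((Ncol (φ i) : ℝ) ^ (Real.log m / Real.log n - 1) /
              ∑ j, (Ncol j : ℝ) ^ (Real.log m / Real.log n))) / Real.log n
        + (1 - Real.log m / Real.log n) *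
          entropy (fun j : Fin M => θ ^ t * (1 / (M : ℝ)) +
            (1 - θ ^ t) * ((Ncol j : ℝ) ^ (Real.log m / Real.log n) /
              ∑ j', (Ncol j' : ℝ) ^ (Real.log m / Real.log n))) / Real.log m)
      0 1 := by
  set s := Real.log m / Real.log n
  have hpos' : ∀ j, 0 < (Ncol j : ℝ) := fun j => by exact_mod_cast hpos j
  have : Nonempty (Fin M) := ⟨⟨0, by omega⟩⟩
  have hS : ∑ j, (Ncol j : ℝ) ^ s ≠ 0 :=
    (Finset.sum_pos (fun j _ => Real.rpow_pos_of_pos (hpos' j) s) Finset.univ_nonempty).ne'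
  have hq : ∑ j, (Ncol j : ℝ) ^ s / ∑ j', (Ncol j' : ℝ) ^ s = 1 := by
    rw [← Finset.sum_div, div_self hS]
  have hp : ∑ i, (Ncol (φ i) : ℝ) ^ (s - 1) / ∑ j, (Ncol j : ℝ) ^ s = 1 := by
    rw [← Finset.sum_div, div_eq_one_iff_eq hS, ← Finset.sum_fiberwise' Finset.univ φ
      (fun j => (Ncol j : ℝ) ^ (s - 1))]
    refine Finset.sum_congr rfl fun j _ => ?_
    rw [Finset.sum_const, hφ, nsmul_eq_mul, Real.rpow_sub_one (hpos' j).ne',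
      mul_div_cancel₀ _ (hpos' j).ne']
  simpa using ((hasDerivAt_entropy_mix_uniform _ hp t).div_const (Real.log n)).fun_add
    (((hasDerivAt_entropy_mix_uniform _ hq t).const_mul (1 - s)).div_const (Real.log m))
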